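/- Let L be a totally real number field of degree ℓ and let k ≥ 3 be an integer. Then there exist infinitely many totally real number fields F containing L, of degree kℓ over ℚ, with m(F) ≥ m(L). -/

import Mathlib

open scoped NumberField

def TotallyPositive (F : Type*) [Field F] (x : F) : Prop :=
  ∀ φ : F →+* ℝ, 0 < φ x

def IsTotallyRealField (F : Type*) [Field F] : Prop :=
  ∀ φ : F →+* ℂ, ∀ x : F, (φ x).im = 0

def IsTotPosLattice (F : Type*) [Field F] (r : ℕ)
    (Λ : Submodule (𝓞 F) (Fin r → F)) (Q : QuadraticForm F (Fin r → F)) : Prop :=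
  Λ.FG ∧ Submodule.span F (Λ : Set (Fin r → F)) = ⊤ ∧
    (∀ v ∈ Λ, ∃ a : 𝓞 F, (a : F) = Q v) ∧
    (∀ v : Fin r → F, v ≠ 0 → TotallyPositive F (Q v))

def IsUniversalLattice (F : Type*) [Field F] (r : ℕ)
    (Λ : Submodule (𝓞 F) (Fin r → F)) (Q : QuadraticForm F (Fin r → F)) : Prop :=
  IsTotPosLattice F r Λ Q ∧
    ∀ a : 𝓞 F, TotallyPositive F (a : F) → ∃ v ∈ Λ, Q v = (a : F)

noncomputable def minUnivRank (F : Type*) [Field F] : ℕ :=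
  sInf { r | ∃ Λ Q, IsUniversalLattice F r Λ Q }

open Polynomial in
/-- A monic integral polynomial of degree `k`, Eisenstein at `p`, all of whose roots are real. -/
noncomputable def realEisensteinPoly (p k : ℕ) : ℤ[X] :=
  ∏ i ∈ Finset.range k, (X - C (4 * p * i : ℤ)) + C (p : ℤ)

section RealEisensteinPoly

open Polynomial

theorem degree_C_lt_degree_prod_X_sub_C {p k : ℕ} (hk : 0 < k) :
    (C (p : ℤ)).degree < (∏ i ∈ Finset.range k, (X - C (4 * p * i : ℤ))).degree := by
  rw [degree_prod]
  simp only [degree_X_sub_C, Finset.sum_const, Finset.card_range, nsmul_eq_mul, mul_one]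
  exact degree_C_le.trans_lt (by exact_mod_cast hk)

theorem realEisensteinPoly_monic (p : ℕ) {k : ℕ} (hk : 0 < k) : (realEisensteinPoly p k).Monic :=
  (monic_prod_of_monic _ _ fun _ _ => monic_X_sub_C _).add_of_left
    (degree_C_lt_degree_prod_X_sub_C hk)

theorem realEisensteinPoly_natDegree (p : ℕ) {k : ℕ} (hk : 0 < k) :
    (realEisensteinPoly p k).natDegree = k := by
  rw [realEisensteinPoly, natDegree_add_eq_left_of_degree_lt (degree_C_lt_degree_prod_X_sub_C hk),
    natDegree_prod_of_monic _ _ fun _ _ => monic_X_sub_C _]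
  simp only [natDegree_X_sub_C, Finset.sum_const, Finset.card_range, smul_eq_mul, mul_one]

theorem realEisensteinPoly_coeff_zero (p : ℕ) {k : ℕ} (hk : 0 < k) :
    (realEisensteinPoly p k).coeff 0 = p := by
  rw [realEisensteinPoly, coeff_zero_eq_eval_zero, eval_add, eval_prod,
    Finset.prod_eq_zero (Finset.mem_range.2 hk) (by simp)]
  simp

theorem dvd_realEisensteinPoly_coeff (p : ℕ) {k n : ℕ} (hn : n < k) :
    (p : ℤ) ∣ (realEisensteinPoly p k).coeff n := by
  have h : (realEisensteinPoly p k).map (Int.castRingHom (ZMod p)) = X ^ k := by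
    simp [realEisensteinPoly, Polynomial.map_prod]
  rw [← ZMod.intCast_zmod_eq_zero_iff_dvd]
  have := congrArg (fun q => q.coeff n) h
  simpa [coeff_X_pow, hn.ne] using this

theorem one_le_neg_one_pow_mul_prod_odd {j k : ℕ} (hj : j ≤ k) :
    (1 : ℤ) ≤ (-1) ^ (k - j) * ∏ i ∈ Finset.range k, (2 * (j : ℤ) - 1 - 2 * i) := by
  obtain ⟨n, rfl⟩ := Nat.exists_eq_add_of_le hj
  have h : (-1 : ℤ) ^ n = ∏ i ∈ Finset.range n, (-1) := by simp
  rw [Finset.prod_range_add, Nat.add_sub_cancel_left, mul_left_comm, h,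
    ← Finset.prod_mul_distrib]
  refine Int.add_one_le_of_lt (mul_pos ?_ ?_)
  · exact Finset.prod_pos fun i hi => by have := Finset.mem_range.1 hi; omega
  · exact Finset.prod_pos fun i hi => by push_cast; omega

theorem realEisensteinPoly_splits {p k : ℕ} (hp : 0 < p) (hk : 0 < k) :
    ((realEisensteinPoly p k).map (Int.castRingHom ℝ)).Splits := by
  set f := (realEisensteinPoly p k).map (Int.castRingHom ℝ) with hf
  have hfm : f.Monic := (realEisensteinPoly_monic p hk).map _
  have hfd : f.natDegree = k := by
    rw [hf, (realEisensteinPoly_monic p hk).natDegree_map, realEisensteinPoly_natDegree p hk]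
  let x : ℕ → ℝ := fun j => 2 * p * (2 * j - 1)
  have hp' : (1 : ℝ) ≤ p := by exact_mod_cast hp
  have hx : Monotone x := fun i j hij => by
    have : (i : ℝ) ≤ j := by exact_mod_cast hij
    simp only [x]
    gcongr
  have heval : ∀ j, f.eval (x j) =
      (2 * p : ℝ) ^ k * ((∏ i ∈ Finset.range k, (2 * (j : ℤ) - 1 - 2 * i) : ℤ) : ℝ) + p := by
    intro j
    have : (2 * p : ℝ) ^ k = ∏ i ∈ Finset.range k, (2 * p : ℝ) := by simp
    rw [this]
    push_cast
    rw [← Finset.prod_mul_distrib]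
    simp only [hf, realEisensteinPoly, Polynomial.map_add, Polynomial.map_prod, eval_add, eval_prod,
      Polynomial.map_sub, map_X, map_C, eval_sub, eval_X, eval_C, x]
    congr 1
    exact Finset.prod_congr rfl fun i _ => by simp; ring
  have hsign : ∀ j ≤ k, 0 < (-1 : ℝ) ^ (k - j) * f.eval (x j) := by
    intro j hj
    have h1 : (1 : ℝ) ≤ (-1) ^ (k - j) *
        ((∏ i ∈ Finset.range k, (2 * (j : ℤ) - 1 - 2 * i) : ℤ) : ℝ) := by
      exact_mod_cast one_le_neg_one_pow_mul_prod_odd hj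
    have h2 : (2 * p : ℝ) ≤ (2 * p : ℝ) ^ k := le_self_pow₀ (by linarith) hk.ne'
    rw [heval, mul_add, mul_left_comm]
    have h3 : -(p : ℝ) ≤ (-1 : ℝ) ^ (k - j) * p := by
      rcases neg_one_pow_eq_or ℝ (k - j) with h | h <;> rw [h] <;> linarith
    nlinarith
  have hroot : ∀ j : Fin k, ∃ r, f.eval r = 0 ∧ x j < r ∧ r ≤ x (j + 1) := by
    intro ⟨j, hj⟩
    have h1 := hsign j hj.le
    have h2 := hsign (j + 1) hj
    have hpow : (-1 : ℝ) ^ (k - j) = -(-1) ^ (k - (j + 1)) := by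
      rw [show k - j = k - (j + 1) + 1 by omega, pow_succ]; ring
    have hmem : (0 : ℝ) ∈ Set.uIcc (f.eval (x j)) (f.eval (x (j + 1))) := by
      rw [Set.mem_uIcc]
      rw [hpow] at h1
      rcases neg_one_pow_eq_or ℝ (k - (j + 1)) with h | h <;> rw [h] at h1 h2
      · left; constructor <;> linarith
      · right; constructor <;> linarith
    obtain ⟨r, hr, hr0⟩ := intermediate_value_uIcc (f := fun y => f.eval y)
      f.continuous.continuousOn hmem
    rw [Set.uIcc_of_le (hx j.le_succ)] at hr
    refine ⟨r, hr0, lt_of_le_of_ne hr.1 ?_, hr.2⟩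
    rintro rfl
    simp only at hr0
    simp [hr0] at h1
  choose r hr0 hr1 hr2 using hroot
  have hmono : StrictMono r := fun i j hij =>
    ((hr2 i).trans (hx (Nat.succ_le_of_lt hij))).trans_lt (hr1 j)
  rw [splits_iff_card_roots]
  refine le_antisymm (card_roots' _) ?_
  have hsub : Finset.univ.image r ⊆ f.roots.toFinset := by
    intro y hy
    obtain ⟨i, -, rfl⟩ := Finset.mem_image.1 hy
    rw [Multiset.mem_toFinset, mem_roots hfm.ne_zero]
    exact hr0 i
  calc f.natDegree = (Finset.univ.image r).card := by
        rw [Finset.card_image_of_injective _ hmono.injective, hfd]; simp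
    _ ≤ f.roots.toFinset.card := Finset.card_le_card hsub
    _ ≤ _ := Multiset.toFinset_card_le _

theorem realEisensteinPoly_root_im_eq_zero {p k : ℕ} (hp : 0 < p) (hk : 0 < k) {z : ℂ}
    (hz : aeval z (realEisensteinPoly p k) = 0) : z.im = 0 := by
  have h0 : ((realEisensteinPoly p k).map (Int.castRingHom ℝ)) ≠ 0 :=
    ((realEisensteinPoly_monic p hk).map _).ne_zero
  obtain ⟨y, rfl⟩ := (realEisensteinPoly_splits hp hk).mem_range_of_isRoot (i := algebraMap ℝ ℂ)
    h0 (x := z) (by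
      rwa [IsRoot, eval_map, eval₂_map,
        Subsingleton.elim ((algebraMap ℝ ℂ).comp _) (algebraMap ℤ ℂ), ← aeval_def])
  simp

theorem exists_root_realEisensteinPoly {p k : ℕ} (hp : 0 < p) (hk : 0 < k) :
    ∃ α : ℝ, aeval α (realEisensteinPoly p k) = 0 := by
  obtain ⟨α, hα⟩ := (realEisensteinPoly_splits hp hk).exists_eval_eq_zero (by
    rw [(realEisensteinPoly_monic p hk).degree_map,
      degree_eq_natDegree (realEisensteinPoly_monic p hk).ne_zero, realEisensteinPoly_natDegree p hk]
    exact_mod_cast hk.ne')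
  exact ⟨α, by rwa [eval_map, ← algebraMap_int_eq, ← aeval_def] at hα⟩

/-- A rational prime with an unramified prime above it. -/
theorem NumberField.exists_natCast_mem_notMem_sq (K : Type*) [Field K] [NumberField K] :
    ∃ p : ℕ, p.Prime ∧ ∃ P : Ideal (𝓞 K), P.IsPrime ∧ (p : 𝓞 K) ∈ P ∧ (p : 𝓞 K) ∉ P ^ 2 := by
  obtain ⟨p, hpd, hp⟩ := Nat.exists_infinite_primes ((discr K).natAbs + 1)
  have hpz : Prime (p : ℤ) := Nat.prime_iff_prime_int.1 hp
  have hmax : (Ideal.span {(p : ℤ)}).IsMaximal :=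
    PrincipalIdealRing.isMaximal_of_irreducible hpz.irreducible
  obtain ⟨P, hP, hcomap⟩ := Ideal.exists_ideal_over_maximal_of_isIntegral (S := 𝓞 K)
    (Ideal.span {(p : ℤ)}) (by
      rw [(RingHom.injective_iff_ker_eq_bot _).1 (FaithfulSMul.algebraMap_injective ℤ (𝓞 K))]
      exact bot_le)
  have hpP : (p : 𝓞 K) ∈ P := by
    have : (p : ℤ) ∈ Ideal.comap (algebraMap ℤ (𝓞 K)) P := by
      rw [hcomap]; exact Ideal.mem_span_singleton_self _
    simpa using this
  refine ⟨p, hp, P, hP.isPrime, hpP, fun hsq => ?_⟩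
  have hdvd : P ^ 2 ∣ (Ideal.span {(p : ℤ)}).map (algebraMap ℤ (𝓞 K)) := by
    rw [Ideal.map_span, Set.image_singleton, Ideal.dvd_iff_le, Ideal.span_singleton_le_iff_mem]
    simpa using hsq
  have hdiff := pow_sub_one_dvd_differentIdeal ℤ P 2 (by simpa using hp.ne_zero) hdvd
  have hdisc : ((discr K : ℤ) : 𝓞 K) ∈ P := by
    have := Ideal.dvd_iff_le.1 hdiff (discr_mem_differentIdeal K (𝓞 K))
    simpa using this
  have : discr K ∈ Ideal.span {(p : ℤ)} := by
    rw [← hcomap, Ideal.mem_comap]; simpa using hdisc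
  rw [Ideal.mem_span_singleton, Int.natCast_dvd] at this
  exact absurd (Nat.le_of_dvd (Int.natAbs_pos.2 (discr_ne_zero K)) this) (by omega)

theorem irreducible_realEisensteinPoly_map {K : Type*} [Field K] [NumberField K] {p k : ℕ}
    (hk : 0 < k) {P : Ideal (𝓞 K)} (hP : P.IsPrime) (hpP : (p : 𝓞 K) ∈ P)
    (hpP2 : (p : 𝓞 K) ∉ P ^ 2) :
    Irreducible ((realEisensteinPoly p k).map (Int.castRingHom K)) := by
  have hm := realEisensteinPoly_monic p hk
  have h1 : Irreducible ((realEisensteinPoly p k).map (algebraMap ℤ (𝓞 K))) := by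
    refine IsEisensteinAt.irreducible (𝓟 := P) ⟨?_, ?_, ?_⟩ hP (hm.map _).isPrimitive ?_
    · rw [(hm.map _).leadingCoeff]
      exact fun h => hP.ne_top (P.eq_top_iff_one.2 h)
    · intro n hn
      rw [hm.natDegree_map, realEisensteinPoly_natDegree p hk] at hn
      obtain ⟨c, hc⟩ := dvd_realEisensteinPoly_coeff p hn
      rw [coeff_map, hc]
      simpa using P.mul_mem_right _ hpP
    · rw [coeff_map, realEisensteinPoly_coeff_zero p hk]
      simpa using hpP2
    · rw [hm.natDegree_map, realEisensteinPoly_natDegree p hk]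
      exact hk
  have h2 := ((hm.map _).irreducible_iff_irreducible_map_fraction_map (K := K)).1 h1
  rw [Polynomial.map_map] at h2
  rwa [Subsingleton.elim (Int.castRingHom K) ((algebraMap (𝓞 K) K).comp (algebraMap ℤ (𝓞 K)))]

end RealEisensteinPoly

section Extensions

open Polynomial

theorem mem_range_ofRealHom_of_im_eq_zero {z : ℂ} (hz : z.im = 0) : z ∈ Complex.ofRealHom.range :=
  ⟨z.re, Complex.ext rfl hz.symm⟩

theorem IsTotallyRealField.of_toSubfield_le_closure {F : IntermediateField ℚ ℝ} {T : Set ℝ}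
    (hTF : T ⊆ F) (hFT : F.toSubfield ≤ Subfield.closure T)
    (hT : ∀ (φ : F →+* ℂ) (x : F), (x : ℝ) ∈ T → (φ x).im = 0) : IsTotallyRealField F := by
  intro φ x
  let S : Subfield ℝ := (Complex.ofRealHom.fieldRange.comap φ).map (algebraMap F ℝ)
  have hS : Subfield.closure T ≤ S := Subfield.closure_le.2 fun t ht =>
    ⟨⟨t, hTF ht⟩, mem_range_ofRealHom_of_im_eq_zero (hT φ ⟨t, hTF ht⟩ ht), rfl⟩
  obtain ⟨y, ⟨r, hr⟩, hyx⟩ := hS (hFT x.2)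
  obtain rfl : y = x := Subtype.ext hyx
  rw [← hr]
  exact Complex.ofReal_im r

theorem IsTotallyRealField.of_restrictScalars_eq_adjoin_simple {L F : IntermediateField ℚ ℝ}
    (hL : IsTotallyRealField L) {f : ℤ[X]} (hf : ∀ z : ℂ, aeval z f = 0 → z.im = 0) {α : ℝ}
    (hα : aeval α f = 0)
    (hF : F = IntermediateField.restrictScalars ℚ (IntermediateField.adjoin L {α})) :
    IsTotallyRealField F := by
  have hLF : L ≤ F := fun x hx => hF ▸
    IntermediateField.algebraMap_mem (IntermediateField.adjoin L {α}) ⟨x, hx⟩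
  have hαF : α ∈ F := hF ▸ IntermediateField.mem_adjoin_simple_self L α
  refine IsTotallyRealField.of_toSubfield_le_closure (T := Set.range (algebraMap L ℝ) ∪ {α})
    ?_ ?_ ?_
  · rintro _ (⟨y, rfl⟩ | rfl)
    exacts [hLF y.2, hαF]
  · rw [hF]
    exact le_rfl
  · rintro φ x (⟨y, hy⟩ | hx)
    · obtain rfl : IntermediateField.inclusion hLF y = x := Subtype.ext hy
      exact hL (φ.comp (IntermediateField.inclusion hLF : L →+* F)) y
    · refine hf _ ?_
      have h0 : aeval x f = 0 := Subtype.ext ((aeval_algebraMap_apply ℝ x f).symm.trans (by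
        rwa [show algebraMap F ℝ x = α from hx]))
      have := aeval_algHom_apply (φ.toIntAlgHom) x f
      rw [h0, map_zero] at this
      exact this

/-- Every element of `L(α) ∩ K` lies in `L` as soon as `α` has the same minimal polynomial over
`L` and over a field `K` containing `L`. -/
theorem IntermediateField.mem_of_mem_adjoin_simple_of_mem {L K : IntermediateField ℚ ℝ}
    (hLK : L ≤ K) {α : ℝ} {g : L[X]} (hg : g.Monic) (hgα : aeval α g = 0)
    (hdeg : g.degree ≤ (minpoly K α).degree) {x : ℝ}
    (hx : x ∈ IntermediateField.adjoin L {α}) (hxK : x ∈ K) : x ∈ L := by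
  have hint : IsIntegral L α := ⟨g, hg, hgα⟩
  rw [← IntermediateField.mem_toSubalgebra,
    IntermediateField.adjoin_simple_toSubalgebra_of_isAlgebraic hint.isAlgebraic,
    Algebra.adjoin_singleton_eq_range_aeval] at hx
  obtain ⟨q, rfl⟩ := hx
  set r := q %ₘ g
  have hr : aeval α q = aeval α r := by
    conv_lhs => rw [← modByMonic_add_div q g]
    simp [hgα, r]
  let j : L →+* K := IntermediateField.inclusion hLK
  have hj : aeval α (r.map j) = aeval α r := by
    rw [aeval_def, eval₂_map, aeval_def]; rfl
  have hdr : (r.map j).degree < (minpoly K α).degree :=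
    (degree_map_le.trans_lt (degree_modByMonic_lt q hg)).trans_le hdeg
  have hz : r.map j - C ⟨aeval α q, hxK⟩ = 0 := by
    by_contra hne
    have hpos : 0 < (minpoly K α).degree := minpoly.degree_pos
      ⟨g.map j, hg.map _, by rw [eval₂_map]; exact hgα⟩
    have := minpoly.degree_le_of_ne_zero K α hne (by
      rw [map_sub, hj, aeval_C, ← hr]; exact sub_self _)
    exact absurd ((degree_sub_le _ _).trans_lt (max_lt hdr (degree_C_le.trans_lt hpos))) this.not_gt
  have h0 := congrArg (fun s => ((s.coeff 0 : K) : ℝ)) hz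
  simp only [coeff_sub, coeff_map, coeff_C_zero, coeff_zero] at h0
  have : ((j (r.coeff 0) : K) : ℝ) - aeval α q = 0 := h0
  have h1 : aeval α q = (r.coeff 0 : L) := (sub_eq_zero.1 this).symm
  exact h1 ▸ (r.coeff 0).2

theorem exists_totallyReal_extension_inf_le (L K : IntermediateField ℚ ℝ) [NumberField L]
    [NumberField K] (hL : IsTotallyRealField L) (hLK : L ≤ K) {k : ℕ} (hk : 0 < k) :
    ∃ F : IntermediateField ℚ ℝ, L ≤ F ∧ IsTotallyRealField F ∧
      Module.finrank ℚ F = k * Module.finrank ℚ L ∧ F ⊓ K ≤ L := by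
  obtain ⟨p, hp, P, hP, hpP, hpP2⟩ := NumberField.exists_natCast_mem_notMem_sq K
  have hirr := irreducible_realEisensteinPoly_map hk hP hpP hpP2
  have hm := realEisensteinPoly_monic p hk
  obtain ⟨α, hα⟩ := exists_root_realEisensteinPoly hp.pos hk
  have hroot : ∀ E : IntermediateField ℚ ℝ,
      aeval α ((realEisensteinPoly p k).map (Int.castRingHom E)) = 0 := fun E => by
    rw [aeval_def, eval₂_map, Subsingleton.elim ((algebraMap E ℝ).comp _) (algebraMap ℤ ℝ),
      ← aeval_def, hα]
  have hminK := minpoly.eq_of_irreducible_of_monic hirr (hroot K) (hm.map _)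
  have hirrL : Irreducible ((realEisensteinPoly p k).map (Int.castRingHom L)) := by
    refine (hm.map _).irreducible_of_irreducible_map
      (IntermediateField.inclusion hLK : L →+* K) _ ?_
    rwa [Polynomial.map_map, Subsingleton.elim (RingHom.comp _ _) (Int.castRingHom K)]
  have hminL := minpoly.eq_of_irreducible_of_monic hirrL (hroot L) (hm.map _)
  have hint : IsIntegral L α := ⟨_, hm.map _, hroot L⟩
  refine ⟨IntermediateField.restrictScalars ℚ (IntermediateField.adjoin L {α}), fun x hx => ?_,
    hL.of_restrictScalars_eq_adjoin_simple
      (fun z => realEisensteinPoly_root_im_eq_zero hp.pos hk) hα rfl, ?_, fun x hx => ?_⟩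
  · exact IntermediateField.algebraMap_mem (IntermediateField.adjoin L {α}) ⟨x, hx⟩
  · have h1 := IntermediateField.adjoin.finrank hint
    rw [← hminL, hm.natDegree_map, realEisensteinPoly_natDegree p hk] at h1
    rw [← h1, mul_comm]
    exact (Module.finrank_mul_finrank ℚ L (IntermediateField.adjoin L {α})).symm
  · refine IntermediateField.mem_of_mem_adjoin_simple_of_mem hLK (hm.map (Int.castRingHom L))
      (hroot L) ?_ hx.1 hx.2
    rw [← hminK, hm.degree_map, hm.degree_map]

end Extensions

section SmallIntegers

open Polynomial Module

/-- Real numbers which are, in some subfield of `ℝ` of degree `d` over `ℚ`, algebraic integers all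
of whose conjugates are bounded by `X`. -/
def boundedIntegers (d : ℕ) (X : ℝ) : Set ℝ :=
  {x | ∃ (F : IntermediateField ℚ ℝ) (_ : NumberField F) (y : F), finrank ℚ F = d ∧ (y : ℝ) = x ∧
    IsIntegral ℤ y ∧ ∀ φ : F →+* ℂ, ‖φ y‖ ≤ X}

theorem boundedIntegers_finite (d : ℕ) (X : ℝ) : (boundedIntegers d X).Finite := by
  classical
  let N := ⌈max X 1 ^ d * d.choose (d / 2)⌉₊
  refine (bUnion_roots_finite (algebraMap ℤ ℝ) d (Set.finite_Icc (-N : ℤ) N)).subset ?_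
  rintro _ ⟨F, _, y, rfl, rfl, hint, hy⟩
  simp_rw [Set.mem_iUnion]
  have hmin := minpoly.isIntegrallyClosed_eq_field_fractions' ℚ hint
  refine ⟨minpoly ℤ y, ⟨?_, fun i => ?_⟩, ?_⟩
  · rw [← (minpoly.monic hint).natDegree_map (algebraMap ℤ ℚ), ← hmin]
    exact minpoly.natDegree_le y
  · rw [Set.mem_Icc, ← abs_le, ← @Int.cast_le ℝ]
    refine (Eq.trans_le ?_ <| NumberField.Embeddings.coeff_bdd_of_norm_le hy i).trans
      (Nat.le_ceil _)
    rw [hmin, coeff_map, eq_intCast, Int.norm_cast_rat, Int.norm_eq_abs, Int.cast_abs]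
  · rw [Finset.mem_coe, Multiset.mem_toFinset,
      mem_roots ((minpoly.monic hint).map _).ne_zero, IsRoot, eval_map, ← aeval_def]
    exact (aeval_algebraMap_apply ℝ y _).trans (by rw [minpoly.aeval, map_zero])

theorem boundedIntegers_isIntegral {d : ℕ} {X x : ℝ} (hx : x ∈ boundedIntegers d X) :
    IsIntegral ℚ x := by
  obtain ⟨F, _, y, -, rfl, -⟩ := hx
  exact (IsIntegral.of_finite ℚ y).map (IsScalarTower.toAlgHom ℚ F ℝ)

/-- Totally real extensions of `L` of relative degree `k` in which every algebraic integer with all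
conjugates bounded by `X` lies in `L`. -/
def extensionsWithSmallIntegersIn (L : IntermediateField ℚ ℝ) (k : ℕ) (X : ℝ) :
    Set (IntermediateField ℚ ℝ) :=
  {F | L ≤ F ∧ IsTotallyRealField F ∧ finrank ℚ F = k * finrank ℚ L ∧
    ∀ y : F, IsIntegral ℤ y → (∀ φ : F →+* ℂ, ‖φ y‖ ≤ X) → (y : ℝ) ∈ L}

theorem extensionsWithSmallIntegersIn_infinite (L : IntermediateField ℚ ℝ) [NumberField L]
    (hL : IsTotallyRealField L) {k : ℕ} (hk : 2 ≤ k) (X : ℝ) :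
    (extensionsWithSmallIntegersIn L k X).Infinite := by
  have hLpos : 0 < finrank ℚ L := finrank_pos
  have hkpos : 0 < k * finrank ℚ L := by positivity
  intro hfin
  have := hfin.to_subtype
  have := (boundedIntegers_finite (k * finrank ℚ L) X).to_subtype
  have hB : FiniteDimensional ℚ (IntermediateField.adjoin ℚ
      (boundedIntegers (k * finrank ℚ L) X)) :=
    IntermediateField.finiteDimensional_adjoin fun x hx => boundedIntegers_isIntegral hx
  have hfd : ∀ F : extensionsWithSmallIntegersIn L k X, FiniteDimensional ℚ F.1 := fun F =>
    FiniteDimensional.of_finrank_pos (by rw [F.2.2.2.1]; exact hkpos)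
  have hS := IntermediateField.finiteDimensional_iSup_of_finite
    (t := fun F : extensionsWithSmallIntegersIn L k X => F.1)
  set S := ⨆ F : extensionsWithSmallIntegersIn L k X, F.1
  set B := IntermediateField.adjoin ℚ (boundedIntegers (k * finrank ℚ L) X)
  have hK : NumberField (L ⊔ B ⊔ S : IntermediateField ℚ ℝ) :=
    { to_finiteDimensional := inferInstance }
  obtain ⟨F, hLF, hF, hdeg, hinf⟩ := exists_totallyReal_extension_inf_le L (L ⊔ B ⊔ S) hL
    (le_sup_left.trans le_sup_left) (zero_lt_two.trans_le hk)
  have hFfd : FiniteDimensional ℚ F := FiniteDimensional.of_finrank_pos (hdeg ▸ hkpos)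
  have hFnf : NumberField F := { to_finiteDimensional := hFfd }
  have hFmem : F ∈ extensionsWithSmallIntegersIn L k X := ⟨hLF, hF, hdeg, fun y hy hyX =>
    hinf ⟨y.2, le_sup_left (a := L ⊔ B) (le_sup_right (a := L)
      (IntermediateField.subset_adjoin ℚ _ ⟨F, hFnf, y, hdeg, rfl, hy, hyX⟩))⟩⟩
  have hFS : F ≤ S :=
    le_iSup (fun F : extensionsWithSmallIntegersIn L k X => F.1) ⟨F, hFmem⟩
  have hFL : F = L := le_antisymm ((le_inf le_rfl (hFS.trans le_sup_right)).trans hinf) hLF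
  rw [hFL] at hdeg
  nlinarith

end SmallIntegers

section Units

open NumberField NumberField.InfinitePlace NumberField.Units NumberField.Units.dirichletUnitTheorem
  Module

variable (F : Type*) [Field F] [NumberField F]

open scoped Classical in
theorem NumberField.Units.exists_norm_sub_logEmbedding_le :
    ∃ R : ℝ, ∀ y : logSpace F, ∃ u : (𝓞 F)ˣ, ‖y - logEmbedding F (Additive.ofMul u)‖ ≤ R := by
  classical
  let b := (basisUnitLattice F).ofZLatticeBasis ℝ (unitLattice F)
  refine ⟨∑ i, ‖b i‖, fun y => ?_⟩
  have hmem : (ZSpan.floor b y : logSpace F) ∈ unitLattice F := by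
    rw [← (basisUnitLattice F).ofZLatticeBasis_span ℝ (unitLattice F)]
    exact (ZSpan.floor b y).2
  obtain ⟨u, -, hu⟩ := hmem
  refine ⟨u.toMul, ?_⟩
  have h := ZSpan.norm_fract_le b y
  rw [ZSpan.fract_apply, ← hu] at h
  exact h

/-- Multiplying by the square of a unit, one can make all archimedean absolute values of an element
comparable to each other. -/
theorem NumberField.Units.exists_place_sq_mul_le :
    ∃ C : ℝ, ∀ α : F, α ≠ 0 → ∃ u : (𝓞 F)ˣ, ∀ v w : InfinitePlace F,
      v ((u : F) ^ 2 * α) ≤ C * w ((u : F) ^ 2 * α) := by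
  classical
  obtain ⟨R, hR⟩ := exists_norm_sub_logEmbedding_le F
  let R' : ℝ := Fintype.card (InfinitePlace F) * R
  refine ⟨Real.exp (4 * R'), fun α hα => ?_⟩
  let M : ℝ := ∑ w : InfinitePlace F, (mult w : ℝ)
  let t : ℝ := (∑ w : InfinitePlace F, mult w * Real.log (w α)) / M
  have hM : M ≠ 0 := by
    have : 0 < M := Finset.sum_pos (fun w _ => Nat.cast_pos.2 mult_pos) Finset.univ_nonempty
    exact this.ne'
  obtain ⟨u, hu⟩ := hR fun w => -(1 / 2) * (mult w.1 * (Real.log (w.1 α) - t))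
  let e : InfinitePlace F → ℝ := fun w => mult w * (Real.log (w u) + (Real.log (w α) - t) / 2)
  have hR0 : 0 ≤ R := (norm_nonneg _).trans hu
  have he : ∀ w ≠ w₀, |e w| ≤ R := by
    intro w hw
    have := (norm_le_pi_norm _ (⟨w, hw⟩ : {w : InfinitePlace F // w ≠ w₀})).trans hu
    rw [Pi.sub_apply, logEmbedding_component, Real.norm_eq_abs, ← abs_neg] at this
    refine le_of_eq_of_le (congrArg abs ?_) this
    simp only [e]
    ring
  have hsum : ∑ w, e w = 0 := by
    have h1 : ∑ w, e w = ∑ w : InfinitePlace F, mult w * Real.log (w u) +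
        ((∑ w : InfinitePlace F, mult w * Real.log (w α)) - t * M) / 2 := by
      simp only [e, M, Finset.mul_sum, ← Finset.sum_sub_distrib, Finset.sum_div,
        ← Finset.sum_add_distrib]
      exact Finset.sum_congr rfl fun w _ => by ring
    rw [h1, sum_mult_mul_log, div_mul_cancel₀ _ hM]
    simp
  have hcard : (1 : ℝ) ≤ Fintype.card (InfinitePlace F) := by
    exact_mod_cast Fintype.card_pos
  have he' : ∀ w, |e w| ≤ R' := by
    intro w
    by_cases hw : w = w₀
    · subst hw
      have : e w₀ = -∑ w ∈ Finset.univ.erase w₀, e w := by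
        rw [← Finset.add_sum_erase _ _ (Finset.mem_univ w₀)] at hsum
        linarith
      rw [this, abs_neg]
      refine (Finset.abs_sum_le_sum_abs _ _).trans
        ((Finset.sum_le_card_nsmul _ _ R fun w hw => he w (Finset.ne_of_mem_erase hw)).trans ?_)
      rw [nsmul_eq_mul]
      have : (Finset.univ.erase (w₀ : InfinitePlace F)).card ≤ Fintype.card (InfinitePlace F) :=
        Finset.card_le_univ _
      exact mul_le_mul_of_nonneg_right (by exact_mod_cast this) hR0
    · exact (he w hw).trans (le_mul_of_one_le_left hR0 hcard)
  have hlog : ∀ w : InfinitePlace F, |Real.log (w ((u : F) ^ 2 * α)) - t| ≤ 2 * R' := by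
    intro w
    have hwu : w (u : F) ≠ 0 := (pos_at_place u w).ne'
    have hwα : w α ≠ 0 := (pos_iff.2 hα).ne'
    have h1 : |Real.log (w u) + (Real.log (w α) - t) / 2| ≤ |e w| := by
      rw [abs_mul]
      refine le_mul_of_one_le_left (abs_nonneg _) ?_
      rw [abs_of_pos (Nat.cast_pos.2 mult_pos)]
      exact_mod_cast one_le_mult
    have h2 := h1.trans (he' w)
    rw [map_mul, map_pow, Real.log_mul (pow_ne_zero _ hwu) hwα, Real.log_pow]
    rw [abs_le] at h2 ⊢
    push_cast
    constructor <;> linarith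
  refine ⟨u, fun v w => ?_⟩
  have hne : (u : F) ^ 2 * α ≠ 0 := mul_ne_zero (pow_ne_zero _ (coe_ne_zero u)) hα
  rw [← Real.exp_log (pos_iff.2 hne : 0 < v _), ← Real.exp_log (pos_iff.2 hne : 0 < w _),
    ← Real.exp_add, Real.exp_le_exp]
  have hv := abs_le.1 (hlog v)
  have hw := abs_le.1 (hlog w)
  linarith

end Units

section Decomposition

open NumberField

theorem IsTotallyRealField.exists_real_embedding {F : Type*} [Field F] (hF : IsTotallyRealField F)
    (φ : F →+* ℂ) : ∃ ψ : F →+* ℝ, ∀ x, φ x = (ψ x : ℂ) := by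
  have h : ∀ x, φ x = ((φ x).re : ℂ) := fun x => Complex.ext rfl (hF φ x)
  refine ⟨{ toFun := fun x => (φ x).re
            map_one' := by simp
            map_zero' := by simp
            map_add' := by simp
            map_mul' := fun x y => by simp [hF φ x] }, h⟩

theorem IsTotallyRealField.nonempty_real_embedding {F : Type*} [Field F] [NumberField F]
    (hF : IsTotallyRealField F) : Nonempty (F →+* ℝ) := by
  obtain ⟨ψ, -⟩ := hF.exists_real_embedding (Classical.arbitrary (F →+* ℂ))
  exact ⟨ψ⟩

theorem sum_range_ite_lt {n : ℕ} {r : ℤ} (h0 : 0 ≤ r) (hr : r ≤ n) :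
    ∑ t ∈ Finset.range n, (if (t : ℤ) < r then 1 else 0 : ℤ) = r := by
  lift r to ℕ using h0
  rw [Finset.sum_boole]
  have : (Finset.range n).filter (fun t : ℕ => (t : ℤ) < (r : ℤ)) = Finset.range r := by
    ext t
    simp only [Finset.mem_filter, Finset.mem_range]
    omega
  rw [this, Finset.card_range]

variable {F : Type*} [Field F] [NumberField F]

theorem finite_totallyPositive_le (hF : IsTotallyRealField F) (B : ℝ) :
    {s : 𝓞 F | TotallyPositive F (s : F) ∧ ∀ φ : F →+* ℝ, φ s ≤ B}.Finite := by
  refine Set.Finite.of_finite_image ((Embeddings.finite_of_norm_le F ℂ B).subset ?_)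
    (RingOfIntegers.coe_injective.injOn)
  rintro _ ⟨s, ⟨hs, hB⟩, rfl⟩
  refine ⟨s.isIntegral_coe, fun φ => ?_⟩
  obtain ⟨ψ, hψ⟩ := hF.exists_real_embedding φ
  rw [hψ, Complex.norm_real, Real.norm_of_nonneg (hs ψ).le]
  exact hB ψ

/-- Totally positive integers with comparable conjugates are sums of elements of a finite set of
totally positive integers. -/
theorem exists_finset_totallyPositive_mem_closure (hF : IsTotallyRealField F) (C : ℝ) :
    ∃ S : Finset (𝓞 F), (∀ s ∈ S, TotallyPositive F (s : F)) ∧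
      ∀ α : 𝓞 F, TotallyPositive F (α : F) → (∀ φ ψ : F →+* ℝ, φ α ≤ C * ψ α) →
        α ∈ AddSubmonoid.closure (S : Set (𝓞 F)) := by
  classical
  have := hF.nonempty_real_embedding
  let ω := RingOfIntegers.basis F
  let D : ℝ := ∑ φ : F →+* ℝ, ∑ i, |φ (ω i : F)|
  have hD0 : 0 ≤ D := by positivity
  have hD : ∀ φ : F →+* ℝ, ∑ i, |φ (ω i : F)| ≤ D := fun φ =>
    Finset.single_le_sum (f := fun φ : F →+* ℝ => ∑ i, |φ (ω i : F)|)
      (fun φ _ => by positivity) (Finset.mem_univ φ)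
  let B : ℝ := 2 * C * (D + 1) + D
  have hfin := finite_totallyPositive_le hF B
  refine ⟨hfin.toFinset, fun s hs => (hfin.mem_toFinset.1 hs).1, fun α hα hC => ?_⟩
  rw [hfin.coe_toFinset]
  obtain ⟨ψ, hψ⟩ := Finite.exists_min fun ψ : F →+* ℝ => ψ (α : F)
  have hμ : 0 < ψ (α : F) := hα ψ
  have hC1 : 1 ≤ C := by
    have := hC ψ ψ
    by_contra! h
    nlinarith
  set n : ℕ := ⌊ψ (α : F) / (D + 1)⌋₊ with hn
  have hn2 : ψ (α : F) < (n + 1) * (D + 1) := by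
    rw [← div_lt_iff₀ (by positivity)]; exact Nat.lt_floor_add_one _
  have hn1 : n * (D + 1) ≤ ψ (α : F) := by
    rw [← le_div_iff₀ (by positivity)]; exact Nat.floor_le (by positivity)
  rcases Nat.eq_zero_or_pos n with h0 | hpos
  · refine AddSubmonoid.subset_closure ⟨hα, fun φ => (hC φ ψ).trans ?_⟩
    rw [h0] at hn2
    simp only [B]
    push_cast at hn2
    nlinarith
  let a : _ → ℤ := fun i => ω.repr α i
  have hα_sum : α = ∑ i, a i • ω i := (ω.sum_repr α).symm
  let c : ℕ → _ → ℤ := fun t i => a i / n + if (t : ℤ) < a i % n then 1 else 0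
  let γ : ℕ → 𝓞 F := fun t => ∑ i, c t i • ω i
  have hnz : (0 : ℤ) < n := by exact_mod_cast hpos
  have hsum : α = ∑ t ∈ Finset.range n, γ t := by
    simp only [γ]
    rw [Finset.sum_comm, hα_sum]
    refine Finset.sum_congr rfl fun i _ => ?_
    rw [← Finset.sum_smul]
    congr 1
    simp only [c]
    rw [Finset.sum_add_distrib, sum_range_ite_lt (Int.emod_nonneg _ hnz.ne')
      (Int.emod_lt_of_pos _ hnz).le, Finset.sum_const, Finset.card_range, nsmul_eq_mul]
    exact (Int.mul_ediv_add_emod _ _).symm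
  rw [hsum]
  refine AddSubmonoid.sum_mem _ fun t _ => AddSubmonoid.subset_closure ?_
  have hnR : (1 : ℝ) ≤ n := by exact_mod_cast hpos
  have hdiff : ∀ φ : F →+* ℝ, |n * φ (γ t : F) - φ (α : F)| ≤ n * D := by
    intro φ
    have h1 : n * φ (γ t : F) - φ (α : F) = ∑ i, ((n * c t i - a i : ℤ) : ℝ) * φ (ω i : F) := by
      conv_lhs => rw [hα_sum]
      simp only [γ, map_sum, Finset.mul_sum, ← Finset.sum_sub_distrib, zsmul_eq_mul, map_mul,
        map_intCast]
      exact Finset.sum_congr rfl fun i _ => by push_cast; ring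
    rw [h1]
    calc |∑ i, ((n * c t i - a i : ℤ) : ℝ) * φ (ω i : F)|
        ≤ ∑ i, |((n * c t i - a i : ℤ) : ℝ) * φ (ω i : F)| := Finset.abs_sum_le_sum_abs _ _
      _ ≤ ∑ i, n * |φ (ω i : F)| := by
        refine Finset.sum_le_sum fun i _ => ?_
        rw [abs_mul]
        refine mul_le_mul_of_nonneg_right ?_ (abs_nonneg _)
        have h2 : |n * c t i - a i| ≤ (n : ℤ) := by
          have h3 := Int.mul_ediv_add_emod (a i) n
          have h4 := Int.emod_nonneg (a i) hnz.ne'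
          have h5 := Int.emod_lt_of_pos (a i) hnz
          simp only [c]
          rw [mul_add, abs_le]
          split_ifs <;> constructor <;> linarith
        exact_mod_cast h2
      _ = n * ∑ i, |φ (ω i : F)| := by rw [Finset.mul_sum]
      _ ≤ n * D := mul_le_mul_of_nonneg_left (hD φ) (by positivity)
  refine ⟨fun φ => ?_, fun φ => ?_⟩
  · have h1 := (abs_le.1 (hdiff φ)).1
    have h2 := hψ φ
    have : 0 < n * φ (γ t : F) := by nlinarith
    exact pos_of_mul_pos_right this (by positivity)
  · have h1 := (abs_le.1 (hdiff φ)).2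
    have h2 := hC φ ψ
    have h3 : C * ψ (α : F) ≤ C * (2 * n * (D + 1)) := by
      refine mul_le_mul_of_nonneg_left (hn2.le.trans ?_) (by linarith)
      nlinarith
    have : n * φ (γ t : F) ≤ n * B := by simp only [B]; nlinarith
    exact le_of_mul_le_mul_left this (by positivity)

end Decomposition

section Universal

open NumberField

/-- The lattice of integral vectors in `F ^ r`. -/
def standardLattice (F : Type*) [Field F] (r : ℕ) : Submodule (𝓞 F) (Fin r → F) :=
  LinearMap.range ((Algebra.linearMap (𝓞 F) F).compLeft (Fin r))

theorem mem_standardLattice {F : Type*} [Field F] {r : ℕ} {v : Fin r → F} :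
    v ∈ standardLattice F r ↔ ∃ x : Fin r → 𝓞 F, (fun i => (x i : F)) = v := Iff.rfl

theorem isTotPosLattice_weightedSumSquares {F : Type*} [Field F] {r : ℕ} (w : Fin r → 𝓞 F)
    (hw : ∀ i, TotallyPositive F (w i : F)) :
    IsTotPosLattice F r (standardLattice F r)
      (QuadraticMap.weightedSumSquares F fun i => (w i : F)) := by
  classical
  refine ⟨?_, ?_, ?_, ?_⟩
  · rw [standardLattice, LinearMap.range_eq_map]
    exact (Module.Finite.fg_top (R := 𝓞 F) (M := Fin r → 𝓞 F)).map _
  · rw [eq_top_iff, ← (Pi.basisFun F (Fin r)).span_eq]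
    refine Submodule.span_mono ?_
    rintro _ ⟨i, rfl⟩
    refine mem_standardLattice.2 ⟨Pi.single i 1, ?_⟩
    ext j
    rw [Pi.basisFun_apply]
    by_cases h : j = i
    · subst h; simp
    · simp [h]
  · intro v hv
    obtain ⟨x, rfl⟩ := mem_standardLattice.1 hv
    refine ⟨∑ i, w i * (x i * x i), ?_⟩
    simp [QuadraticMap.weightedSumSquares_apply]
  · intro v hv φ
    obtain ⟨i, hi⟩ := Function.ne_iff.1 hv
    rw [QuadraticMap.weightedSumSquares_apply, map_sum]
    refine Finset.sum_pos' (fun j _ => ?_) ⟨i, Finset.mem_univ i, ?_⟩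
    · rw [smul_eq_mul, map_mul, map_mul]
      exact mul_nonneg (hw j φ).le (mul_self_nonneg _)
    · rw [smul_eq_mul, map_mul, map_mul]
      exact mul_pos (hw i φ) (mul_self_pos.2 ((map_ne_zero φ).2 hi))

theorem exists_sum_mul_self_of_mem_closure {R : Type*} [CommRing R] (S : Finset R) {a : R}
    (ha : a ∈ AddSubmonoid.closure (S : Set R)) :
    ∃ x : S × Fin 4 → R, a = ∑ p, (p.1 : R) * (x p * x p) := by
  obtain ⟨n, -, rfl⟩ := AddSubmonoid.mem_closure_finset.1 ha
  choose x y z t h using fun s => Nat.sum_four_squares (n s)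
  refine ⟨fun p => ![x p.1, y p.1, z p.1, t p.1] p.2, ?_⟩
  rw [Fintype.sum_prod_type, ← Finset.sum_coe_sort S]
  refine Finset.sum_congr rfl fun s _ => ?_
  rw [← h]
  simp [Fin.sum_univ_four, nsmul_eq_mul]
  ring

/-- Totally real number fields have universal lattices. -/
theorem IsTotallyRealField.exists_isUniversalLattice {F : Type*} [Field F] [NumberField F]
    (hF : IsTotallyRealField F) : ∃ r Λ Q, IsUniversalLattice F r Λ Q := by
  classical
  obtain ⟨C, hC⟩ := Units.exists_place_sq_mul_le F
  obtain ⟨S, hS, hdec⟩ := exists_finset_totallyPositive_mem_closure hF C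
  let e := (Fintype.equivFin (S × Fin 4)).symm
  refine ⟨_, _, _, isTotPosLattice_weightedSumSquares (fun i => ((e i).1 : 𝓞 F))
    fun i => hS _ (e i).1.2, fun a ha => ?_⟩
  have ha0 : (a : F) ≠ 0 := by
    rintro h
    obtain ⟨φ⟩ := hF.nonempty_real_embedding
    have := ha φ
    rw [h, map_zero] at this
    exact this.false
  obtain ⟨u, hu⟩ := hC a ha0
  have hcoe : (((u : 𝓞 F) ^ 2 * a : 𝓞 F) : F) = ((u : 𝓞 F) : F) ^ 2 * (a : F) := by
    simp
  have hpos : TotallyPositive F (((u : 𝓞 F) ^ 2 * a : 𝓞 F) : F) := fun φ => by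
    have : φ ((u : 𝓞 F) : F) ≠ 0 := (map_ne_zero φ).2 (Units.coe_ne_zero u)
    have := ha φ
    rw [hcoe, map_mul, map_pow]
    positivity
  obtain ⟨x, hx⟩ := exists_sum_mul_self_of_mem_closure S (hdec _ hpos fun φ ψ => by
    have key : ∀ φ : F →+* ℝ, φ (((u : 𝓞 F) ^ 2 * a : 𝓞 F) : F) =
        InfinitePlace.mk (Complex.ofRealHom.comp φ) (((u : 𝓞 F) : F) ^ 2 * a) := fun φ => by
      have := hpos φ
      rw [hcoe] at this ⊢
      rw [InfinitePlace.apply, RingHom.comp_apply, Complex.ofRealHom_eq_coe, Complex.norm_real,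
        Real.norm_of_nonneg this.le]
    rw [key, key]
    exact hu _ _)
  refine ⟨_, mem_standardLattice.2 ⟨fun i => ((u⁻¹ : (𝓞 F)ˣ) : 𝓞 F) * x (e i), rfl⟩, ?_⟩
  have h1 : a = ∑ i, ((e i).1 : 𝓞 F) * ((((u⁻¹ : (𝓞 F)ˣ) : 𝓞 F) * x (e i)) *
      (((u⁻¹ : (𝓞 F)ˣ) : 𝓞 F) * x (e i))) := by
    rw [e.sum_comp fun p => (p.1 : 𝓞 F) * ((((u⁻¹ : (𝓞 F)ˣ) : 𝓞 F) * x p) *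
      (((u⁻¹ : (𝓞 F)ˣ) : 𝓞 F) * x p))]
    calc a = ((u⁻¹ : (𝓞 F)ˣ) : 𝓞 F) ^ 2 * ((u : 𝓞 F) ^ 2 * a) := by
          rw [← mul_assoc, ← mul_pow, Units.inv_mul, one_pow, one_mul]
      _ = _ := by
          rw [hx, Finset.mul_sum]
          exact Finset.sum_congr rfl fun p _ => by ring
  conv_rhs => rw [h1]
  simp [QuadraticMap.weightedSumSquares_apply]

end Universal

section Nondegenerate

open NumberField Module

theorem QuadraticMap.polar_eq_zero_of_nonneg {L V : Type*} [Field L] [CharZero L] [AddCommGroup V]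
    [Module L V] {q : QuadraticForm L V} (σ : L →+* ℝ) (hq : ∀ x, 0 ≤ σ (q x)) {x : V}
    (hx : q x = 0) (y : V) : QuadraticMap.polar q x y = 0 := by
  by_contra h
  set p := QuadraticMap.polar q x y with hp
  have h1 := hq ((-(q y + 1) / p) • x + y)
  have h2 : q ((-(q y + 1) / p) • x + y) = -1 := by
    rw [QuadraticMap.map_add q, QuadraticMap.map_smul, QuadraticMap.polar_smul_left, hx, ← hp]
    simp only [smul_eq_mul]
    field_simp
    ring
  rw [h2, map_neg, map_one] at h1
  linarith

/-- An integral totally positive definite lattice is finitely generated. -/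
theorem fg_of_integral {L : Type*} [Field L] [NumberField L] {d : ℕ}
    (Λ : Submodule (𝓞 L) (Fin d → L)) (Q : QuadraticForm L (Fin d → L))
    (hspan : Submodule.span L (Λ : Set (Fin d → L)) = ⊤)
    (hint : ∀ v ∈ Λ, ∃ a : 𝓞 L, (a : L) = Q v) (hQ : ∀ v, Q v = 0 → v = 0) : Λ.FG := by
  classical
  let b := Basis.ofSpan hspan.ge
  have hb : ∀ i, b i ∈ Λ := fun i => Basis.ofSpan_subset hspan.ge ⟨i, rfl⟩
  let e := b.indexEquiv (Pi.basisFun L (Fin d))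
  let c := b.reindex e
  have hc : ∀ i, c i ∈ Λ := fun i => by rw [Basis.reindex_apply]; exact hb _
  let g : (Fin d → L) →ₗ[L] (Fin d → L) :=
    LinearMap.pi fun i => (QuadraticMap.polarBilin Q).flip (c i)
  have hg : Function.Injective g := by
    rw [← LinearMap.ker_eq_bot, LinearMap.ker_eq_bot']
    intro v hv
    have h1 : QuadraticMap.polarBilin Q v = 0 := c.ext fun i => by
      simpa [g] using congrFun hv i
    have h2 : QuadraticMap.polar Q v v = 0 := by
      simpa using LinearMap.congr_fun h1 v
    rw [QuadraticMap.polar_self] at h2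
    exact hQ v (by simpa using h2)
  refine Submodule.fg_of_fg_map_injective (g.restrictScalars (𝓞 L)) hg ?_
  refine Submodule.FG.of_le (T := standardLattice L d) ?_ ?_
  · rw [standardLattice, LinearMap.range_eq_map]
    exact (Module.Finite.fg_top (R := 𝓞 L) (M := Fin d → 𝓞 L)).map _
  · rintro _ ⟨v, hv, rfl⟩
    have : ∀ i, ∃ a : 𝓞 L, (a : L) = g v i := fun i => by
      obtain ⟨a₁, h₁⟩ := hint _ (Λ.add_mem hv (hc i))
      obtain ⟨a₂, h₂⟩ := hint _ hv
      obtain ⟨a₃, h₃⟩ := hint _ (hc i)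
      refine ⟨a₁ - a₂ - a₃, ?_⟩
      simp [g, QuadraticMap.polar, ← h₁, ← h₂, ← h₃]
    choose a ha using this
    exact mem_standardLattice.2 ⟨a, funext ha⟩

/-- A positive semidefinite form of rank at most `r`, integral and universal on a spanning module,
yields a universal lattice of rank at most `r`. -/
theorem exists_isUniversalLattice_of_semidefinite {L V : Type*} [Field L] [NumberField L]
    [AddCommGroup V] [Module L V] [Module (𝓞 L) V] [IsScalarTower (𝓞 L) L V]
    (hL : IsTotallyRealField L) (q : QuadraticForm L V) {r : ℕ}
    (hq : ∀ (σ : L →+* ℝ) x, 0 ≤ σ (q x))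
    (hr : ∀ x : Fin (r + 1) → V, ∃ c : Fin (r + 1) → L, c ≠ 0 ∧ q (∑ i, c i • x i) = 0)
    (M : Submodule (𝓞 L) V) (hM : Submodule.span L (M : Set V) = ⊤)
    (hint : ∀ x ∈ M, ∃ a : 𝓞 L, (a : L) = q x)
    (huniv : ∀ a : 𝓞 L, TotallyPositive L (a : L) → ∃ x ∈ M, q x = (a : L)) :
    ∃ d ≤ r, ∃ Λ Q, IsUniversalLattice L d Λ Q := by
  classical
  obtain ⟨σ₀⟩ := hL.nonempty_real_embedding
  have hpol : ∀ {x}, q x = 0 → ∀ y, QuadraticMap.polar q x y = 0 := fun hx y =>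
    QuadraticMap.polar_eq_zero_of_nonneg σ₀ (hq σ₀) hx y
  have hadd : ∀ {x}, q x = 0 → ∀ y, q (x + y) = q y := fun {x} hx y => by
    rw [QuadraticMap.map_add q, hpol hx, hx, zero_add, add_zero]
  let R : Submodule L V :=
    { carrier := {x | q x = 0}
      zero_mem' := QuadraticMap.map_zero q
      add_mem' := fun {x y} hx hy => (hadd hx y).trans hy
      smul_mem' := fun c x (hx : q x = 0) => by
        change q (c • x) = 0
        rw [QuadraticMap.map_smul, hx, smul_zero] }
  have hrank : Module.rank L (V ⧸ R) ≤ (r : ℕ) := by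
    refine rank_le fun s hs => ?_
    by_contra! hcard
    obtain ⟨t, hts, ht⟩ := Finset.exists_subset_card_eq (Nat.succ_le_of_lt hcard)
    let e := (t.equivFinOfCardEq ht).symm
    have hindep : LinearIndependent L fun i => ((e i : t) : V ⧸ R) :=
      hs.comp (fun i => ⟨e i, hts (e i).2⟩) fun i j hij => by
        simpa [Subtype.ext_iff] using hij
    choose x hx using fun i => R.mkQ_surjective ((e i : t) : V ⧸ R)
    obtain ⟨c, hc0, hc⟩ := hr x
    refine hc0 (funext (Fintype.linearIndependent_iff.1 hindep c ?_))
    simp only [← hx, ← map_smul, ← map_sum]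
    exact (Submodule.Quotient.mk_eq_zero R).2 hc
  have hfin : Module.Finite L (V ⧸ R) :=
    Module.rank_lt_aleph0_iff.1 (hrank.trans_lt (Cardinal.natCast_lt_aleph0))
  let e := (finBasis L (V ⧸ R)).equivFun
  let π : V →ₗ[L] (Fin (finrank L (V ⧸ R)) → L) := e.toLinearMap ∘ₗ R.mkQ
  have hπ : Function.Surjective π := e.surjective.comp R.mkQ_surjective
  have hker : ∀ x, π x = 0 → q x = 0 := fun x hx => by
    have : R.mkQ x = 0 := e.map_eq_zero_iff.1 hx
    exact (Submodule.Quotient.mk_eq_zero R).1 this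
  obtain ⟨s, hs⟩ := π.exists_rightInverse_of_surjective (LinearMap.range_eq_top.2 hπ)
  have hs' : ∀ v, π (s v) = v := LinearMap.congr_fun hs
  have hqs : ∀ x, q (s (π x)) = q x := fun x => by
    have h := hadd (hker (s (π x) - x) (by rw [map_sub, hs', sub_self])) x
    rwa [sub_add_cancel] at h
  have hspan : Submodule.span L
      (M.map (π.restrictScalars (𝓞 L)) : Set (Fin (finrank L (V ⧸ R)) → L)) = ⊤ := by
    rw [Submodule.map_coe, LinearMap.coe_restrictScalars, Submodule.span_image, hM,
      Submodule.map_top, LinearMap.range_eq_top.2 hπ]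
  have hint' : ∀ v ∈ M.map (π.restrictScalars (𝓞 L)), ∃ a : 𝓞 L, (a : L) = q.comp s v := by
    rintro _ ⟨x, hx, rfl⟩
    obtain ⟨a, ha⟩ := hint x hx
    exact ⟨a, by simp [ha, hqs]⟩
  have hzero : ∀ v, q.comp s v = 0 → v = 0 := fun v hv => by
    have : R.mkQ (s v) = 0 := (Submodule.Quotient.mk_eq_zero R).2 hv
    rw [← hs' v]
    simp only [π, LinearMap.comp_apply, this, map_zero]
  refine ⟨finrank L (V ⧸ R), by exact_mod_cast (finrank_eq_rank L (V ⧸ R)).trans_le hrank,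
    M.map (π.restrictScalars (𝓞 L)), q.comp s,
    ⟨fg_of_integral _ _ hspan hint' hzero, hspan, hint', fun v hv σ => ?_⟩, fun a ha => ?_⟩
  · exact lt_of_le_of_ne (hq σ (s v)) fun h => hv (hzero v ((map_eq_zero σ).1 h.symm))
  · obtain ⟨x, hx, hxa⟩ := huniv a ha
    exact ⟨π x, ⟨x, hx, rfl⟩, (hqs x).trans hxa⟩

end Nondegenerate

section Limit

open NumberField Filter

theorem exists_real_extension {L F : Type*} [Field L] [Field F] [NumberField F] [Algebra L F]
    [CharZero L] (hF : IsTotallyRealField F) (σ : L →+* ℝ) :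
    ∃ τ : F →+* ℝ, ∀ x, τ (algebraMap L F x) = σ x := by
  have : Algebra.IsAlgebraic L F := Algebra.IsAlgebraic.tower_top (K := ℚ) L
  let _ : Algebra L ℂ := (Complex.ofRealHom.comp σ).toAlgebra
  obtain ⟨τ, hτ⟩ := hF.exists_real_embedding (IsAlgClosed.lift (R := L) (S := F) (M := ℂ)).toRingHom
  refine ⟨τ, fun x => ?_⟩
  have h := hτ (algebraMap L F x)
  rw [AlgHom.toRingHom_eq_coe, RingHom.coe_coe, AlgHom.commutes] at h
  exact (Complex.ofReal_injective h).symm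

theorem abs_polar_le {F : Type*} [Field F] {V : Type*} [AddCommGroup V] [Module F V]
    (Q : QuadraticForm F V) (σ : F →+* ℝ) (hQ : ∀ x, 0 ≤ σ (Q x)) (x y : V) :
    |σ (QuadraticMap.polar Q x y)| ≤ σ (Q x) + σ (Q y) := by
  have h1 := hQ (x + y)
  have h2 := hQ (x - y)
  rw [QuadraticMap.map_add Q, map_add, map_add] at h1
  rw [sub_eq_add_neg, QuadraticMap.map_add Q, QuadraticMap.polar_neg_right, QuadraticMap.map_neg,
    map_add, map_add, map_neg] at h2
  rw [abs_le]
  constructor <;> linarith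

theorem det_polar_eq_zero {F : Type*} [Field F] {d r : ℕ} (hd : d ≤ r)
    (Q : QuadraticForm F (Fin d → F)) (x : Fin (r + 1) → Fin d → F) :
    (Matrix.of fun i j => QuadraticMap.polar Q (x i) (x j)).det = 0 := by
  have hdep : ¬ LinearIndependent F x := fun h => by
    have := h.fintype_card_le_finrank
    simp at this
    omega
  obtain ⟨c, hc, i, hi⟩ := Fintype.not_linearIndependent_iff.1 hdep
  refine Matrix.exists_mulVec_eq_zero_iff.1 ⟨c, fun h => hi (congrFun h i), ?_⟩
  ext j
  have := congrArg (QuadraticMap.polarBilin Q (x j)) hc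
  simpa [Matrix.mulVec, dotProduct, mul_comm] using this

theorem exists_eq_zero_of_det_polar_eq_zero {L V ι : Type*} [Field L] [CharZero L] [AddCommGroup V]
    [Module L V] [Fintype ι] [DecidableEq ι] (q : QuadraticForm L V) (x : ι → V)
    (h : (Matrix.of fun i j => QuadraticMap.polar q (x i) (x j)).det = 0) :
    ∃ c : ι → L, c ≠ 0 ∧ q (∑ i, c i • x i) = 0 := by
  obtain ⟨c, hc0, hc⟩ := Matrix.exists_mulVec_eq_zero_iff.2 h
  refine ⟨c, hc0, ?_⟩
  have h1 : ∀ i, QuadraticMap.polarBilin q (x i) (∑ j, c j • x j) = 0 := fun i => by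
    simpa [Matrix.mulVec, dotProduct, mul_comm] using congrFun hc i
  have h2 : QuadraticMap.polarBilin q (∑ i, c i • x i) (∑ j, c j • x j) = 0 := by
    rw [LinearMap.map_sum₂]
    exact Finset.sum_eq_zero fun i _ => by rw [map_smul, LinearMap.smul_apply, h1, smul_zero]
  rw [QuadraticMap.polarBilin_apply_apply, QuadraticMap.polar_self] at h2
  simpa using h2

/-- The quadratic form on `S →₀ L` with prescribed polar values on the standard basis. -/
noncomputable def gramForm {L S : Type*} [Field L] (G : S → S → L) : QuadraticForm L (S →₀ L) :=
  LinearMap.BilinMap.toQuadraticMap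
    (Finsupp.linearCombination L fun a => Finsupp.linearCombination L fun b => G a b / 2)

theorem gramForm_apply {L S : Type*} [Field L] (G : S → S → L) (c : S →₀ L) :
    gramForm G c = ∑ a ∈ c.support, ∑ b ∈ c.support, c a * (c b * (G a b / 2)) := by
  rw [gramForm, LinearMap.BilinMap.toQuadraticMap_apply, Finsupp.linearCombination_apply,
    Finsupp.sum, LinearMap.sum_apply]
  refine Finset.sum_congr rfl fun a _ => ?_
  rw [LinearMap.smul_apply, Finsupp.linearCombination_apply, Finsupp.sum, Finset.smul_sum]
  rfl

theorem algebraMap_gramForm {L F S : Type*} [Field L] [Field F] [CharZero F] [Algebra L F]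
    (G : S → S → L) {d : ℕ} (Q : QuadraticForm F (Fin d → F)) (v : S → Fin d → F) (c : S →₀ L)
    (h : ∀ a ∈ c.support, ∀ b ∈ c.support,
      algebraMap L F (G a b) = QuadraticMap.polar Q (v a) (v b)) :
    algebraMap L F (gramForm G c) = Q (Finsupp.linearCombination L v c) := by
  have h1 : Finsupp.linearCombination L v c = ∑ a ∈ c.support, algebraMap L F (c a) • v a := by
    rw [Finsupp.linearCombination_apply, Finsupp.sum]
    exact Finset.sum_congr rfl fun a _ => (algebraMap_smul F _ _).symm
  have h2 : QuadraticMap.polarBilin Q (Finsupp.linearCombination L v c)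
      (Finsupp.linearCombination L v c) = 2 * algebraMap L F (gramForm G c) := by
    rw [h1, gramForm_apply, LinearMap.map_sum₂, map_sum, Finset.mul_sum]
    refine Finset.sum_congr rfl fun a ha => ?_
    rw [map_smul, LinearMap.smul_apply, map_sum, map_sum, Finset.smul_sum, Finset.mul_sum]
    refine Finset.sum_congr rfl fun b hb => ?_
    rw [map_smul, QuadraticMap.polarBilin_apply_apply, ← h a ha b hb]
    simp only [smul_eq_mul, map_mul, map_div₀, map_ofNat]
    field_simp
  rw [QuadraticMap.polarBilin_apply_apply, QuadraticMap.polar_self, two_nsmul, ← two_mul] at h2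
  exact (mul_left_cancel₀ two_ne_zero h2).symm

/-- If a sequence of totally real extensions of `L`, eventually without new integers of any given
size, have universal lattices of rank at most `r`, then so does `L`. -/
theorem exists_isUniversalLattice_of_extensions {L : Type*} [Field L] [NumberField L]
    (hL : IsTotallyRealField L) {r : ℕ} (F : ℕ → Type*) [∀ n, Field (F n)] [∀ n, NumberField (F n)]
    [∀ n, Algebra L (F n)] (hF : ∀ n, IsTotallyRealField (F n))
    (hsmall : ∀ X : ℝ, ∀ᶠ n in atTop, ∀ y : F n, IsIntegral ℤ y →
      (∀ φ : F n →+* ℂ, ‖φ y‖ ≤ X) → ∃ x : L, algebraMap L (F n) x = y)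
    (hlat : ∀ n, ∃ d ≤ r, ∃ Λ Q, IsUniversalLattice (F n) d Λ Q) :
    ∃ d ≤ r, ∃ Λ Q, IsUniversalLattice L d Λ Q := by
  classical
  choose d hd Λ Q hlat huniv using hlat
  have hpos : ∀ n (τ : F n →+* ℝ) x, 0 ≤ τ (Q n x) := fun n τ x => by
    rcases eq_or_ne x 0 with rfl | hx
    · rw [QuadraticMap.map_zero, map_zero]
    · exact ((hlat n).2.2.2 x hx τ).le
  let S := {a : 𝓞 L // TotallyPositive L (a : L)}
  have hrep : ∀ n (a : S), ∃ v ∈ Λ n, Q n v = algebraMap L (F n) (a.1 : L) := fun n a => by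
    have := huniv n (algebraMap (𝓞 L) (𝓞 (F n)) a.1) fun τ => a.2 (τ.comp (algebraMap L (F n)))
    exact this
  choose v hvΛ hvQ using hrep
  let U : Ultrafilter ℕ := hyperfilter ℕ
  have hU : (U : Filter ℕ) ≤ atTop := Nat.hyperfilter_le_atTop
  have hG : ∀ a b : S, ∃ g : L, ∀ᶠ n in (U : Filter ℕ),
      algebraMap L (F n) g = QuadraticMap.polar (Q n) (v n a) (v n b) := by
    intro a b
    let X : ℝ := ∑ σ : L →+* ℝ, (σ (a.1 : L) + σ (b.1 : L))
    have hX : ∀ n (φ : F n →+* ℂ), ‖φ (QuadraticMap.polar (Q n) (v n a) (v n b))‖ ≤ X := by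
      intro n φ
      obtain ⟨τ, hτ⟩ := (hF n).exists_real_embedding φ
      rw [hτ, Complex.norm_real, Real.norm_eq_abs]
      refine (abs_polar_le (Q n) τ (hpos n τ) _ _).trans ?_
      rw [hvQ, hvQ]
      exact Finset.single_le_sum (f := fun σ : L →+* ℝ => σ (a.1 : L) + σ (b.1 : L))
        (fun σ _ => (add_pos (a.2 σ) (b.2 σ)).le) (Finset.mem_univ (τ.comp (algebraMap L (F n))))
    have hint : ∀ n, IsIntegral ℤ (QuadraticMap.polar (Q n) (v n a) (v n b)) := fun n => by
      obtain ⟨a₁, h₁⟩ := (hlat n).2.2.1 _ ((Λ n).add_mem (hvΛ n a) (hvΛ n b))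
      obtain ⟨a₂, h₂⟩ := (hlat n).2.2.1 _ (hvΛ n a)
      obtain ⟨a₃, h₃⟩ := (hlat n).2.2.1 _ (hvΛ n b)
      rw [QuadraticMap.polar, ← h₁, ← h₂, ← h₃]
      exact (a₁.isIntegral_coe.sub a₂.isIntegral_coe).sub a₃.isIntegral_coe
    have hev : ∀ᶠ n in (U : Filter ℕ), ∃ g ∈ {x : L | IsIntegral ℤ x ∧ ∀ φ : L →+* ℂ, ‖φ x‖ ≤ X},
        algebraMap L (F n) g = QuadraticMap.polar (Q n) (v n a) (v n b) := by
      filter_upwards [hU (hsmall X)] with n hn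
      obtain ⟨g, hg⟩ := hn _ (hint n) (hX n)
      refine ⟨g, ⟨?_, fun φ => ?_⟩, hg⟩
      · rw [← isIntegral_algebraMap_iff (algebraMap L (F n)).injective, hg]
        exact hint n
      · obtain ⟨σ, hσ⟩ := hL.exists_real_embedding φ
        obtain ⟨τ, hτ⟩ := exists_real_extension (hF n) σ
        have := hX n (Complex.ofRealHom.comp τ)
        rwa [← hg, RingHom.comp_apply, hτ, Complex.ofRealHom_eq_coe, ← hσ] at this
    obtain ⟨g, -, hg⟩ := (Ultrafilter.eventually_exists_mem_iff
      (Embeddings.finite_of_norm_le L ℂ X)).1 hev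
    exact ⟨g, hg⟩
  choose G hG using hG
  let T : ∀ n, (S →₀ L) →ₗ[L] (Fin (d n) → F n) := fun n => Finsupp.linearCombination L (v n)
  have hq : ∀ c : S →₀ L, ∀ᶠ n in (U : Filter ℕ),
      algebraMap L (F n) (gramForm G c) = Q n (T n c) := fun c => by
    have : ∀ᶠ n in (U : Filter ℕ), ∀ a ∈ c.support, ∀ b ∈ c.support,
        algebraMap L (F n) (G a b) = QuadraticMap.polar (Q n) (v n a) (v n b) :=
      (c.support.eventually_all).2 fun a _ => (c.support.eventually_all).2 fun b _ => hG a b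
    filter_upwards [this] with n hn using algebraMap_gramForm G (Q n) (v n) c hn
  have hpol : ∀ x y : S →₀ L, ∀ᶠ n in (U : Filter ℕ),
      algebraMap L (F n) (QuadraticMap.polar (gramForm G) x y) =
        QuadraticMap.polar (Q n) (T n x) (T n y) := fun x y => by
    filter_upwards [hq (x + y), hq x, hq y] with n h₁ h₂ h₃
    rw [QuadraticMap.polar, map_sub, map_sub, h₁, h₂, h₃, map_add, QuadraticMap.polar]
  let M : Submodule (𝓞 L) (S →₀ L) :=
    Submodule.span (𝓞 L) (Set.range fun a : S => Finsupp.single a 1)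
  have hTM : ∀ n, ∀ x ∈ M, T n x ∈ Λ n := fun n x hx => by
    induction hx using Submodule.span_induction with
    | mem x hx =>
      obtain ⟨a, rfl⟩ := hx
      simpa [T] using hvΛ n a
    | zero => simp
    | add x y _ _ hx hy => rw [map_add]; exact (Λ n).add_mem hx hy
    | smul s x _ hx =>
      have : T n (s • x) = algebraMap (𝓞 L) (𝓞 (F n)) s • T n x := by
        rw [← algebraMap_smul L s x, map_smul]
        ext i
        rw [Pi.smul_apply, Pi.smul_apply, Algebra.smul_def, Algebra.smul_def]
        rfl
      rw [this]
      exact (Λ n).smul_mem _ hx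
  refine exists_isUniversalLattice_of_semidefinite hL (gramForm G) (r := r) (fun σ c => ?_)
    (fun x => ?_) M ?_ (fun x hx => ?_) fun a ha => ?_
  · obtain ⟨n, hn⟩ := (hq c).exists
    obtain ⟨τ, hτ⟩ := exists_real_extension (hF n) σ
    rw [← hτ, hn]
    exact hpos n τ _
  · refine exists_eq_zero_of_det_polar_eq_zero _ x ?_
    obtain ⟨n, hn⟩ := (eventually_all.2 fun i => eventually_all.2 fun j =>
      hpol (x i) (x j)).exists
    rw [← map_eq_zero (algebraMap L (F n)), RingHom.map_det]
    convert det_polar_eq_zero (hd n) (Q n) fun i => T n (x i) using 2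
    ext i j
    exact hn i j
  · rw [eq_top_iff, ← Finsupp.basisSingleOne.span_eq (R := L) (ι := S)]
    refine Submodule.span_mono ?_
    rintro _ ⟨a, rfl⟩
    exact Submodule.subset_span ⟨a, by simp⟩
  · obtain ⟨n, hn⟩ := (hq x).exists
    obtain ⟨b, hb⟩ := (hlat n).2.2.1 _ (hTM n x hx)
    have : IsIntegral ℤ (gramForm G x) := by
      rw [← isIntegral_algebraMap_iff (algebraMap L (F n)).injective, hn, ← hb]
      exact b.isIntegral_coe
    exact ⟨⟨_, this⟩, rfl⟩
  · refine ⟨Finsupp.single ⟨a, ha⟩ 1, Submodule.subset_span ⟨_, rfl⟩, ?_⟩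
    obtain ⟨n, hn⟩ := (hq (Finsupp.single ⟨a, ha⟩ 1)).exists
    refine (algebraMap L (F n)).injective (hn.trans ?_)
    simpa [T] using hvQ n ⟨a, ha⟩

end Limit

theorem exists_bound_minUnivRank_le (L : IntermediateField ℚ ℝ) [NumberField L]
    (hL : IsTotallyRealField L) {k : ℕ} (hk : 0 < k) :
    ∃ X : ℝ, ∀ F ∈ extensionsWithSmallIntegersIn L k X, minUnivRank L ≤ minUnivRank F := by
  by_contra! h
  have hpos : 0 < Module.finrank ℚ L := Module.finrank_pos
  choose F hF hlt using fun n : ℕ => h n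
  have hnf : ∀ n, NumberField (F n) := fun n =>
    { to_finiteDimensional := FiniteDimensional.of_finrank_pos
        (by rw [(hF n).2.2.1]; exact Nat.mul_pos hk hpos) }
  let _ : ∀ n, Algebra L (F n) := fun n => (IntermediateField.inclusion (hF n).1).toRingHom.toAlgebra
  obtain ⟨d, hd, Λ, Q, hu⟩ := exists_isUniversalLattice_of_extensions hL
    (r := minUnivRank L - 1) (fun n => F n) (fun n => (hF n).2.1) (fun X => by
      filter_upwards [Filter.eventually_ge_atTop ⌈X⌉₊] with n hn y hy hyX
      exact ⟨⟨y, (hF n).2.2.2 y hy fun φ => (hyX φ).trans (Nat.ceil_le.1 hn)⟩, rfl⟩) fun n =>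
      ⟨minUnivRank (F n), Nat.le_sub_one_of_lt (hlt n),
        Nat.sInf_mem (hF n).2.1.exists_isUniversalLattice⟩
  have h1 : minUnivRank L ≤ d := Nat.sInf_le ⟨Λ, Q, hu⟩
  have h2 := hlt 0
  omega

theorem infinitely_many_lifts (ℓ : ℕ) (hℓ : 0 < ℓ)
    (L : IntermediateField ℚ ℝ) [NumberField L] (hLtr : IsTotallyRealField L)
    (hLdeg : Module.finrank ℚ L = ℓ) (k : ℕ) (hk : 3 ≤ k) :
    {F : IntermediateField ℚ ℝ | L ≤ F ∧ IsTotallyRealField F ∧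
      Module.finrank ℚ F = k * ℓ ∧ minUnivRank ↥L ≤ minUnivRank ↥F}.Infinite := by
  obtain ⟨X, hX⟩ := exists_bound_minUnivRank_le L hLtr (k := k) (by omega)
  refine (extensionsWithSmallIntegersIn_infinite L hLtr (k := k) (by omega) X).mono fun F hF => ?_
  exact ⟨hF.1, hF.2.1, hLdeg ▸ hF.2.2.1, hX F hF⟩
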